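/- arXiv:2003.12271 — 7 statements merged into one kernel-verified Lean document; each statement's English description precedes it below -/
import Mathlib

section
/- If f covers g in the poset E(P) (i.e. f > g and there is no h ∈ E(P) with f > h > g), then #supp(f) = #supp(g) + 1. -/
open Classical

/-- An order filter (upper set) of a poset. -/
def IsOrderFilter {P : Type*} [PartialOrder P] (F : Set P) : Prop :=
  ∀ ⦃u v : P⦄, u ∈ F → u ≤ v → v ∈ F

/-- The support of an integer-valued map. -/
def zsupp {P : Type*} (f : P → ℤ) : Set P := {v | f v ≠ 0}

/-- Membership in `E(P)`. -/
def IsEF {P : Type*} [PartialOrder P] (f : P → ℤ) : Prop :=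
  (∀ v, f v = 1 ∨ f v = 0 ∨ f v = -1) ∧
  IsOrderFilter (zsupp f) ∧
  ∀ v ∈ zsupp f, ¬ Minimal (· ∈ zsupp f) v → f v = 1

/-- The strict relation `f > g` on `E(P)`. -/
def egt {P : Type*} [PartialOrder P] (f g : P → ℤ) : Prop :=
  zsupp g ⊂ zsupp f ∧
  (∀ v ∈ zsupp g, g v ≤ f v) ∧
  ∀ v ∈ zsupp g, Minimal (· ∈ zsupp f) v → f v = g v

/-- The relation `f ≥ g` on `E(P)`. -/
def ege {P : Type*} [PartialOrder P] (f g : P → ℤ) : Prop := f = g ∨ egt f g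

/-- A chain in the poset `E(P)`. -/
def IsEChain {P : Type*} [PartialOrder P] (K : Set (P → ℤ)) : Prop :=
  (∀ f ∈ K, IsEF f) ∧ IsChain ege K

/-- A maximal chain in the poset `E(P)`. -/
def IsMaxEChain {P : Type*} [PartialOrder P] (K : Set (P → ℤ)) : Prop :=
  IsEChain K ∧ ∀ L, IsEChain L → K ⊆ L → K = L

/-- The set of minimal elements of a subset. -/
def minSet {P : Type*} [PartialOrder P] (F : Set P) : Set P := {v | Minimal (· ∈ F) v}

/-- The signature of a chain in `E(P)`. -/
noncomputable def esgn {P : Type*} [PartialOrder P] (K : Set (P → ℤ)) (v : P) : ℤ :=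
  if h : ∃ f ∈ K, Minimal (· ∈ zsupp f) v then h.choose v else 0

/-- The enriched transfer map. -/
noncomputable def ePhi {P : Type*} [PartialOrder P] (f : P → ℤ) : P → ℝ :=
  fun v => if Minimal (· ∈ zsupp f) v then (f v : ℝ) else 0

/-- The simplex `T^e_K` attached to a chain `K` in `E(P)`. -/
noncomputable def Tsimp {P : Type*} [PartialOrder P] (K : Set (P → ℤ)) : Set (P → ℝ) :=
  convexHull ℝ (ePhi '' K)

/-- Indicator of the set of minimal elements of `F`. -/
noncomputable def chiMin {P : Type*} [PartialOrder P] (F : Set P) : P → ℝ :=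
  fun v => if Minimal (· ∈ F) v then 1 else 0

/-- The simplex `T_C` attached to a chain `C` of order filters. -/
noncomputable def TCsimp {P : Type*} [PartialOrder P] (C : Set (Set P)) : Set (P → ℝ) :=
  convexHull ℝ (chiMin '' C)

/-- The sign-change map `R_φ`. -/
def Rmap {P : Type*} (φ : P → ℤ) (g : P → ℝ) : P → ℝ :=
  fun v => if φ v = -1 then -g v else g v

/-- The orthant-type region `V_φ`. -/
def Vset {P : Type*} (φ : P → ℤ) : Set (P → ℝ) :=
  {g | ∀ v, (φ v = 1 → 0 ≤ g v) ∧ (φ v = 0 → g v = 0) ∧ (φ v = -1 → g v ≤ 0)}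

/-- The set `eA(P)` of `±1`-indicator vectors of antichains, inside `ℝ^P`. -/
def eAset (P : Type*) [PartialOrder P] : Set (P → ℝ) :=
  {g | (∀ v, g v = 1 ∨ g v = 0 ∨ g v = -1) ∧ IsAntichain (· ≤ ·) {v | g v ≠ 0}}

/-- The enriched chain polytope `eC(P)`. -/
noncomputable def eChainPolytope (P : Type*) [PartialOrder P] : Set (P → ℝ) :=
  convexHull ℝ (eAset P)

/-- The chain polytope `C(P)`. -/
noncomputable def chainPolytope (P : Type*) [PartialOrder P] : Set (P → ℝ) :=
  convexHull ℝ {g : P → ℝ | ∃ A : Set P, IsAntichain (· ≤ ·) A ∧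
    g = fun v => if v ∈ A then 1 else 0}

/-- If `a` lies in `zsupp f` but not in `zsupp g` and is minimal in `zsupp f`, this is the map
with support `zsupp f \ {a}` that interpolates between `f` and `g`. -/
noncomputable def eraseInterp {P : Type*} [PartialOrder P] (f g : P → ℤ) (a v : P) : ℤ :=
  if v = a then 0
  else if v ∈ zsupp g ∧ Minimal (· ∈ zsupp f \ {a}) v then g v else f v

lemma zsupp_eraseInterp {P : Type*} [PartialOrder P] {f g : P → ℤ} (a : P) :
    zsupp (eraseInterp f g a) = zsupp f \ {a} := by
  ext v
  change eraseInterp f g a v ≠ 0 ↔ f v ≠ 0 ∧ v ≠ a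
  unfold eraseInterp
  split_ifs with h₁ h₂
  · simp [h₁]
  · have hg : g v ≠ 0 := h₂.1
    have hf : f v ≠ 0 := h₂.2.prop.1
    simp [hg, hf, h₁]
  · simp [h₁]

lemma minimal_diff_singleton {P : Type*} [PartialOrder P] {F : Set P} {a v : P}
    (hv : Minimal (· ∈ F) v) (hva : v ≠ a) : Minimal (· ∈ F \ {a}) v :=
  ⟨⟨hv.prop, hva⟩, fun _ hw hwv => hv.le_of_le hw.1 hwv⟩

lemma isEF_eraseInterp {P : Type*} [PartialOrder P] {f g : P → ℤ} (hf : IsEF f) (hg : IsEF g)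
    {a : P} (ha : Minimal (· ∈ zsupp f) a) : IsEF (eraseInterp f g a) := by
  refine ⟨fun v => ?_, ?_, ?_⟩
  · unfold eraseInterp
    split_ifs
    · simp
    · exact hg.1 v
    · exact hf.1 v
  · rw [zsupp_eraseInterp]
    rintro u v ⟨hu, hua⟩ huv
    refine ⟨hf.2.1 hu huv, ?_⟩
    rintro rfl
    exact hua (le_antisymm huv (ha.le_of_le hu huv))
  · rw [zsupp_eraseInterp]
    rintro v ⟨hv, hva⟩ hmin
    rw [eraseInterp, if_neg (show v ≠ a from hva), if_neg fun h => hmin h.2]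
    exact hf.2.2 v hv fun h => hmin (minimal_diff_singleton h hva)

lemma egt_eraseInterp_left {P : Type*} [PartialOrder P] {f g : P → ℤ} (hgt : egt f g) {a : P}
    (ha : a ∈ zsupp f) : egt f (eraseInterp f g a) := by
  unfold egt
  rw [zsupp_eraseInterp]
  refine ⟨Set.sdiff_singleton_ssubset.2 ha, ?_, ?_⟩
  · rintro v ⟨-, hva⟩
    rw [eraseInterp, if_neg (show v ≠ a from hva)]
    split_ifs with h
    · exact hgt.2.1 v h.1
    · exact le_rfl
  · rintro v ⟨-, hva⟩ hmin
    rw [eraseInterp, if_neg (show v ≠ a from hva)]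
    split_ifs with h
    · exact hgt.2.2 v h.1 hmin
    · rfl

lemma egt_eraseInterp_right {P : Type*} [PartialOrder P] {f g : P → ℤ} (hgt : egt f g) {a : P}
    (ha : a ∉ zsupp g) (hne : zsupp g ≠ zsupp f \ {a}) : egt (eraseInterp f g a) g := by
  unfold egt
  rw [zsupp_eraseInterp]
  refine ⟨(Set.subset_sdiff_singleton hgt.1.subset ha).ssubset_of_ne hne, fun v hv => ?_,
    fun v hv hmin => ?_⟩
  · rw [eraseInterp, if_neg (ne_of_mem_of_not_mem hv ha)]
    split_ifs
    · exact le_rfl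
    · exact hgt.2.1 v hv
  · rw [eraseInterp, if_neg (ne_of_mem_of_not_mem hv ha), if_pos ⟨hv, hmin⟩]

theorem stmt4 {P : Type*} [Fintype P] [PartialOrder P] {f g : P → ℤ}
    (hf : IsEF f) (hg : IsEF g) (hgt : egt f g)
    (hcov : ¬ ∃ h : P → ℤ, IsEF h ∧ egt f h ∧ egt h g) :
    (zsupp f).ncard = (zsupp g).ncard + 1 := by
  obtain ⟨a, ha⟩ := (Set.toFinite (zsupp f \ zsupp g)).exists_minimal
    (Set.nonempty_of_ssubset hgt.1)
  have hmin : Minimal (· ∈ zsupp f) a :=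
    ⟨ha.prop.1, fun b hb hba => ha.le_of_le ⟨hb, fun h => ha.prop.2 (hg.2.1 h hba)⟩ hba⟩
  have heq : zsupp g = zsupp f \ {a} := by
    by_contra hne
    exact hcov ⟨eraseInterp f g a, isEF_eraseInterp hf hg hmin,
      egt_eraseInterp_left hgt hmin.prop, egt_eraseInterp_right hgt ha.prop.2 hne⟩
  rw [heq, Set.ncard_sdiff_singleton_add_one hmin.prop (Set.toFinite _)]
end

section
/- If f is a maximal element of the poset E(P) (i.e. there is no g ∈ E(P) with g > f), then supp(f) = P. -/
open Classical

/-- If `v` lies outside the support of `f ∈ E(P)`, then resetting `f` to `1` on the principal filter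
of `v` gives an element of `E(P)` above `f`. -/
theorem exists_egt_of_notMem_zsupp {P : Type*} [PartialOrder P] {f : P → ℤ} (hf : IsEF f) {v : P}
    (hv : v ∉ zsupp f) : ∃ g : P → ℤ, IsEF g ∧ egt g f := by
  obtain ⟨hval, hfil, hmin⟩ := hf
  set g : P → ℤ := fun u => if v ≤ u then 1 else f u
  have g_of_le : ∀ u, v ≤ u → g u = 1 := fun u h => if_pos h
  have g_of_not_le : ∀ u, ¬ v ≤ u → g u = f u := fun u h => if_neg h
  have hsupp : ∀ u, u ∈ zsupp g ↔ v ≤ u ∨ u ∈ zsupp f := fun u => by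
    by_cases h : v ≤ u
    · simp [zsupp, g_of_le u h, h]
    · simp [zsupp, g_of_not_le u h, h]
  have hvg : v ∈ zsupp g := (hsupp v).2 (Or.inl le_rfl)
  refine ⟨g, ⟨fun u => ?_, fun u w hu huw => ?_, fun u hu hnot => ?_⟩,
    ⟨fun u hu => (hsupp u).2 (Or.inr hu), fun h => hv (h hvg)⟩, fun u _ => ?_, fun u hu hm => ?_⟩
  · by_cases h : v ≤ u
    · exact Or.inl (g_of_le u h)
    · rw [g_of_not_le u h]
      exact hval u
  · rw [hsupp] at hu ⊢
    exact hu.imp (fun h => h.trans huw) (fun h => hfil h huw)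
  · by_cases h : v ≤ u
    · exact g_of_le u h
    · have huf : u ∈ zsupp f := ((hsupp u).1 hu).resolve_left h
      rw [g_of_not_le u h]
      refine hmin u huf fun hm => hnot ⟨hu, fun w hw hwu => ?_⟩
      exact hm.2 (((hsupp w).1 hw).resolve_left fun hvw => h (hvw.trans hwu)) hwu
  · by_cases h : v ≤ u
    · rw [g_of_le u h]
      have := hval u
      omega
    · rw [g_of_not_le u h]
  · refine g_of_not_le u fun h => hv ?_
    rwa [le_antisymm h (hm.2 hvg h)]

theorem stmt5 {P : Type*} [Fintype P] [PartialOrder P] {f : P → ℤ}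
    (hf : IsEF f) (hmax : ¬ ∃ g : P → ℤ, IsEF g ∧ egt g f) :
    zsupp f = Set.univ := by
  by_contra hne
  obtain ⟨v, hv⟩ := (Set.ne_univ_iff_exists_notMem _).1 hne
  exact hmax (exists_egt_of_notMem_zsupp hf hv)
end

section
/- All maximal chains of the poset E(P) have the same length d = #P; that is, every maximal (i.e. not properly contained in another chain) chain of E(P) has exactly d + 1 elements. -/
open Classical

section ChainLength

variable {P : Type*} [PartialOrder P]

theorem egt_trans {f g h : P → ℤ} (hfg : egt f g) (hgh : egt g h) : egt f h := by
  refine ⟨hgh.1.trans hfg.1, fun v hv => (hgh.2.1 v hv).trans (hfg.2.1 v (hgh.1.1 hv)), ?_⟩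
  intro v hv hmin
  have hvg := hgh.1.1 hv
  exact (hfg.2.2 v hvg hmin).trans
    (hgh.2.2 v hv ⟨hvg, fun u hu huv => hmin.2 (hfg.1.1 hu) huv⟩)

theorem egt_of_egt_of_ege {f g h : P → ℤ} (hfg : egt f g) (hgh : ege g h) : egt f h := by
  rcases hgh with rfl | hgh
  · exact hfg
  · exact egt_trans hfg hgh

theorem egt_of_ege_of_egt {f g h : P → ℤ} (hfg : ege f g) (hgh : egt g h) : egt f h := by
  rcases hfg with rfl | hfg
  · exact hgh
  · exact egt_trans hfg hgh

/-- In `E(P)`, condition (ii) of the strict order follows from the other two. -/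
theorem egt_of_ssubset {f g : P → ℤ} (hf : IsEF f) (hg : IsEF g) (hs : zsupp g ⊂ zsupp f)
    (hmin : ∀ v ∈ zsupp g, Minimal (· ∈ zsupp f) v → f v = g v) : egt f g := by
  refine ⟨hs, fun v hv => ?_, hmin⟩
  by_cases h : Minimal (· ∈ zsupp f) v
  · exact (hmin v hv h).ge
  · rw [hf.2.2 v (hs.1 hv) h]
    rcases hg.1 v with h | h | h <;> omega

theorem isEF_zero : IsEF (fun _ : P => (0 : ℤ)) :=
  ⟨fun _ => Or.inr (Or.inl rfl), fun _ _ hu _ => absurd rfl hu, fun _ hv => absurd rfl hv⟩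

theorem ege_zero {f : P → ℤ} : ege f (fun _ => 0) := by
  by_cases h : f = fun _ => 0
  · exact Or.inl h
  · obtain ⟨v, hv⟩ := Function.ne_iff.1 h
    exact Or.inr ⟨⟨fun _ hu => absurd rfl hu, fun hs => hs hv rfl⟩,
      fun _ hu => absurd rfl hu, fun _ hu => absurd rfl hu⟩

theorem IsMaxEChain.mem_of_comparable {K : Set (P → ℤ)} (hK : IsMaxEChain K) {h : P → ℤ}
    (hh : IsEF h) (hc : ∀ k ∈ K, ege h k ∨ ege k h) : h ∈ K := by
  have hL : IsEChain (insert h K) := by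
    refine ⟨?_, hK.1.2.insert fun k hk _ => hc k hk⟩
    rintro k (rfl | hk)
    · exact hh
    · exact hK.1.1 k hk
  rw [hK.2 _ hL (Set.subset_insert h K)]
  exact Set.mem_insert h K

theorem exists_isOrderFilter_insert [Finite P] {S T : Set P} (hS : IsOrderFilter S)
    (hT : IsOrderFilter T) (hST : S ⊂ T) : ∃ v ∈ T, v ∉ S ∧ IsOrderFilter (insert v S) := by
  obtain ⟨v, hv⟩ := (Set.toFinite (T \ S)).exists_maximal (Set.nonempty_of_ssubset hST)
  refine ⟨v, hv.1.1, hv.1.2, ?_⟩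
  rintro u w (rfl | hu) huw
  · by_cases hw : w ∈ S
    · exact Or.inr hw
    · exact Or.inl ((hv.2 ⟨hT hv.1.1 huw, hw⟩ huw).antisymm huw)
  · exact Or.inr (hS hu huw)

/-- Enlarge the support of an element of `E(P)` by a single point `v`, with value `a`. -/
theorem IsEF.exists_insert {g : P → ℤ} (hg : IsEF g) {v : P} (hv : v ∉ zsupp g)
    (hF : IsOrderFilter (insert v (zsupp g))) {a : ℤ} (ha : a = 1 ∨ a = -1) :
    ∃ h : P → ℤ, IsEF h ∧ zsupp h = insert v (zsupp g) ∧ egt h g ∧ h v = a ∧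
      ∀ w ∈ zsupp g, ¬ v < w → h w = g w := by
  set h : P → ℤ := fun w => if w = v then a else if v < w then 1 else g w with h_def
  have hhv : h v = a := by simp [h_def]
  have hlt : ∀ w, v < w → h w = 1 := fun w hw => by simp [h_def, hw, hw.ne']
  have hnlt : ∀ w, w ≠ v → ¬ v < w → h w = g w := fun w hne hw => by simp [h_def, hw, hne]
  have hne : ∀ w ∈ zsupp g, w ≠ v := fun w hw e => hv (e ▸ hw)
  have hs : zsupp h = insert v (zsupp g) := by
    ext w
    by_cases hw : w = v
    · subst hw
      simp only [zsupp, Set.mem_ofPred_eq, Set.mem_insert_iff, true_or, iff_true, hhv]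
      omega
    · by_cases hvw : v < w
      · exact iff_of_true (by simp [zsupp, hlt w hvw]) (hF (Set.mem_insert v _) hvw.le)
      · simp [zsupp, hnlt w hw hvw, hw]
  have hEF : IsEF h := by
    refine ⟨fun w => ?_, hs ▸ hF, fun w hw hmin => ?_⟩
    · by_cases hw : w = v
      · subst hw
        omega
      · by_cases hvw : v < w
        · exact Or.inl (hlt w hvw)
        · rw [hnlt w hw hvw]
          exact hg.1 w
    · by_cases hvw : v < w
      · exact hlt w hvw
      · obtain ⟨u, huw, hu⟩ := (not_minimal_iff_exists_lt hw).1 hmin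
        rw [hs] at hu hw
        rcases hu with rfl | hu
        · exact absurd huw hvw
        · have hwg : w ∈ zsupp g := hg.2.1 hu huw.le
          rw [hnlt w (hne w hwg) hvw]
          exact hg.2.2 w hwg fun hm => (hm.not_lt hu) huw
  refine ⟨h, hEF, hs, egt_of_ssubset hEF hg (hs ▸ Set.ssubset_insert hv) ?_, hhv,
    fun w hw => hnlt w (hne w hw)⟩
  intro w hw hmin
  exact hnlt w (hne w hw) fun hvw => hmin.not_lt (hs ▸ Set.mem_insert v _) hvw

variable [Finite P]

theorem ncard_lt_of_egt {f g : P → ℤ} (h : egt f g) : (zsupp g).ncard < (zsupp f).ncard :=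
  Set.ncard_lt_ncard h.1

theorem IsEChain.ege_of_ncard_le {K : Set (P → ℤ)} (hK : IsEChain K) {f g : P → ℤ}
    (hf : f ∈ K) (hg : g ∈ K) (hc : (zsupp g).ncard ≤ (zsupp f).ncard) : ege f g := by
  by_cases hne : f = g
  · exact Or.inl hne
  · rcases hK.2 hf hg hne with h | rfl | h
    · exact h
    · exact Or.inl rfl
    · exact absurd (ncard_lt_of_egt h) hc.not_gt

theorem IsEChain.injOn_ncard_zsupp {K : Set (P → ℤ)} (hK : IsEChain K) :
    Set.InjOn (fun f => (zsupp f).ncard) K := by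
  intro f hf g hg (hfg : (zsupp f).ncard = (zsupp g).ncard)
  rcases hK.ege_of_ncard_le hf hg hfg.ge with h | h
  · exact h
  · exact absurd (ncard_lt_of_egt h) hfg.not_gt

/-- If `f > g` in `E(P)`, some `h` with `f ≥ h > g` has support one larger than that of `g`. -/
theorem exists_ege_egt_ncard {f g : P → ℤ} (hf : IsEF f) (hg : IsEF g) (hfg : egt f g) :
    ∃ h, IsEF h ∧ egt h g ∧ (zsupp h).ncard = (zsupp g).ncard + 1 ∧
      ((zsupp h).ncard < (zsupp f).ncard → egt f h) := by
  obtain ⟨v, hvf, hvg, hF⟩ := exists_isOrderFilter_insert hg.2.1 hf.2.1 hfg.1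
  have ha : f v = 1 ∨ f v = -1 := by
    rcases hf.1 v with h | h | h
    · exact Or.inl h
    · exact absurd h hvf
    · exact Or.inr h
  obtain ⟨h, hh, hs, hhg, hhv, hhw⟩ := hg.exists_insert hvg hF ha
  refine ⟨h, hh, hhg, by rw [hs, Set.ncard_insert_of_notMem hvg], fun hlt => ?_⟩
  refine egt_of_ssubset hf hh ⟨?_, fun hsub => ?_⟩ fun w hw hmin => ?_
  · rw [hs]
    exact Set.insert_subset hvf hfg.1.1
  · exact hlt.not_ge (Set.ncard_le_ncard hsub)
  · rw [hs] at hw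
    rcases hw with rfl | hw
    · exact hhv.symm
    · rw [hhw w hw (hmin.not_lt hvf)]
      exact hfg.2.2 w hw hmin

theorem IsMaxEChain.exists_ncard_zsupp_eq {K : Set (P → ℤ)} (hK : IsMaxEChain K) (n : ℕ)
    (hn : n ≤ Nat.card P) : ∃ f ∈ K, (zsupp f).ncard = n := by
  induction n with
  | zero =>
    exact ⟨fun _ => 0, hK.mem_of_comparable isEF_zero fun k _ => Or.inr ege_zero,
      by simp [zsupp]⟩
  | succ n ih =>
    obtain ⟨g, hgK, hgn⟩ := ih (by omega)
    have hg := hK.1.1 g hgK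
    by_cases hex : ∃ m, ∃ f ∈ K, (zsupp f).ncard = m ∧ n < m
    · obtain ⟨f, hfK, hfm, hnm⟩ := Nat.find_spec hex
      have hmin : ∀ k ∈ K, n < (zsupp k).ncard → (zsupp f).ncard ≤ (zsupp k).ncard :=
        fun k hk hlt => hfm ▸ Nat.find_min' hex ⟨k, hk, rfl, hlt⟩
      rw [← hfm] at hnm
      have hfg : egt f g := by
        rcases hK.1.ege_of_ncard_le hfK hgK (by omega) with rfl | h
        · omega
        · exact h
      obtain ⟨h, hh, hhg, hhn, hfh⟩ := exists_ege_egt_ncard (hK.1.1 f hfK) hg hfg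
      by_cases hfn : (zsupp f).ncard = n + 1
      · exact ⟨f, hfK, hfn⟩
      · refine ⟨h, hK.mem_of_comparable hh fun k hk => ?_, by omega⟩
        by_cases hkn : n < (zsupp k).ncard
        · exact Or.inr (Or.inr (egt_of_ege_of_egt
            (hK.1.ege_of_ncard_le hk hfK (hmin k hk hkn)) (hfh (by omega))))
        · exact Or.inl (Or.inr (egt_of_egt_of_ege hhg
            (hK.1.ege_of_ncard_le hgK hk (by omega))))
    · have hss : zsupp g ⊂ Set.univ := by
        rw [Set.ssubset_univ_iff]
        intro hu
        rw [hu, Set.ncard_univ] at hgn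
        omega
      obtain ⟨v, -, hvg, hF⟩ :=
        exists_isOrderFilter_insert hg.2.1 (fun _ _ _ _ => Set.mem_univ _) hss
      obtain ⟨h, hh, hs, hhg, -⟩ := hg.exists_insert hvg hF (Or.inl rfl)
      refine ⟨h, hK.mem_of_comparable hh fun k hk => Or.inl (Or.inr (egt_of_egt_of_ege hhg
        (hK.1.ege_of_ncard_le hgK hk ?_))), by rw [hs, Set.ncard_insert_of_notMem hvg, hgn]⟩
      by_contra hlt
      exact hex ⟨_, k, hk, rfl, by omega⟩

end ChainLength

theorem stmt6 {P : Type*} [Fintype P] [PartialOrder P] {K : Set (P → ℤ)}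
    (hK : IsMaxEChain K) : K.ncard = Fintype.card P + 1 := by
  have himage : (fun f => (zsupp f).ncard) '' K = Finset.range (Fintype.card P + 1) := by
    ext n
    rw [Finset.mem_coe, Finset.mem_range, Nat.lt_succ_iff, ← Nat.card_eq_fintype_card]
    refine ⟨?_, fun hn => hK.exists_ncard_zsupp_eq n hn⟩
    rintro ⟨f, -, rfl⟩
    exact Set.ncard_le_card (zsupp f)
  rw [← hK.1.injOn_ncard_zsupp.ncard_image, himage, Set.ncard_coe_finset,
    Finset.card_range]
end

section
/- Let X(P) be the set of all chains of the poset E(P) (including the empty chain), and Y(P) the set of all pairs (C, φ) of a chain C = {F_1 ⊋ F_2 ⊋ ⋯ ⊋ F_k} of order filters of P and a map φ : P → {1,0,-1} satisfying supp(φ) = ⋃_{i=1}^k min(F_i), where min(F_i) is the set of minimal elements of F_i. Then the map X(P) → Y(P) sending K to (supp(K), sgn(K)) is a bijection. -/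
open Classical

/-- The element of `E(P)` with support `F` whose values on the minimal elements of `F` are
prescribed by `φ`. -/
noncomputable def signedFilter {P : Type*} [PartialOrder P] (φ : P → ℤ) (F : Set P) : P → ℤ :=
  fun v => if Minimal (· ∈ F) v then φ v else if v ∈ F then 1 else 0

section SignedFilter

variable {P : Type*} [PartialOrder P]

theorem signedFilter_of_minimal {φ : P → ℤ} {F : Set P} {v : P} (h : Minimal (· ∈ F) v) :
    signedFilter φ F v = φ v :=
  if_pos h

theorem signedFilter_of_mem {φ : P → ℤ} {F : Set P} {v : P} (h : ¬ Minimal (· ∈ F) v)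
    (hv : v ∈ F) : signedFilter φ F v = 1 := by
  simp only [signedFilter, if_neg h, if_pos hv]

theorem signedFilter_of_notMem {φ : P → ℤ} {F : Set P} {v : P} (hv : v ∉ F) :
    signedFilter φ F v = 0 := by
  have h : ¬ Minimal (· ∈ F) v := fun h => hv h.prop
  simp only [signedFilter, if_neg h, if_neg hv]

theorem zsupp_signedFilter {φ : P → ℤ} {F : Set P} (h : minSet F ⊆ zsupp φ) :
    zsupp (signedFilter φ F) = F := by
  ext v
  by_cases hv : v ∈ F
  · refine iff_of_true ?_ hv
    by_cases hm : Minimal (· ∈ F) v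
    · simpa only [zsupp, Set.mem_ofPred_eq, signedFilter_of_minimal hm] using h hm
    · simp [zsupp, signedFilter_of_mem hm hv]
  · simp [zsupp, signedFilter_of_notMem hv, hv]

theorem isEF_signedFilter {φ : P → ℤ} {F : Set P} (h : minSet F ⊆ zsupp φ)
    (hφ : ∀ v, φ v = 1 ∨ φ v = 0 ∨ φ v = -1) (hF : IsOrderFilter F) :
    IsEF (signedFilter φ F) := by
  refine ⟨fun v => ?_, ?_, ?_⟩
  · unfold signedFilter
    split_ifs
    exacts [hφ v, .inl rfl, .inr (.inl rfl)]
  · rwa [zsupp_signedFilter h]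
  · rw [zsupp_signedFilter h]
    exact fun v hv hm => signedFilter_of_mem hm hv

theorem egt_signedFilter {φ : P → ℤ} {F G : Set P} (hF : minSet F ⊆ zsupp φ)
    (hG : minSet G ⊆ zsupp φ) (hφ : ∀ v, φ v = 1 ∨ φ v = 0 ∨ φ v = -1) (hGF : G ⊂ F) :
    egt (signedFilter φ F) (signedFilter φ G) := by
  have heq : ∀ v ∈ G, Minimal (· ∈ F) v → signedFilter φ F v = signedFilter φ G v := by
    intro v hv hm
    rw [signedFilter_of_minimal hm,
      signedFilter_of_minimal ⟨hv, fun w hw => hm.le_of_le (hGF.subset hw)⟩]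
  rw [egt, zsupp_signedFilter hF, zsupp_signedFilter hG]
  refine ⟨hGF, fun v hv => ?_, heq⟩
  by_cases hm : Minimal (· ∈ F) v
  · exact (heq v hv hm).ge
  · rw [signedFilter_of_mem hm (hGF.subset hv)]
    unfold signedFilter
    have := hφ v
    split_ifs <;> lia

theorem esgn_eq_zero {K : Set (P → ℤ)} {v : P} (h : ¬ ∃ f ∈ K, Minimal (· ∈ zsupp f) v) :
    esgn K v = 0 :=
  dif_neg h

theorem exists_esgn_eq {K : Set (P → ℤ)} {v : P} (h : ∃ f ∈ K, Minimal (· ∈ zsupp f) v) :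
    ∃ f ∈ K, Minimal (· ∈ zsupp f) v ∧ esgn K v = f v :=
  ⟨h.choose, h.choose_spec.1, h.choose_spec.2, dif_pos h⟩

theorem egt.eq_of_minimal {f g : P → ℤ} {v : P} (h : egt f g) (hf : Minimal (· ∈ zsupp f) v)
    (hg : Minimal (· ∈ zsupp g) v) : f v = g v :=
  h.2.2 v hg.prop hf

theorem IsEChain.esgn_eq {K : Set (P → ℤ)} (hK : IsEChain K) {f : P → ℤ} (hf : f ∈ K) {v : P}
    (hv : Minimal (· ∈ zsupp f) v) : esgn K v = f v := by
  obtain ⟨g, hg, hgv, h⟩ := exists_esgn_eq ⟨f, hf, hv⟩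
  rw [h]
  by_cases hgf : g = f
  · rw [hgf]
  · rcases hK.2 hg hf hgf with (h | h) | (h | h)
    exacts [congrFun h v, h.eq_of_minimal hgv hv, (congrFun h v).symm,
      (h.eq_of_minimal hv hgv).symm]

theorem IsEChain.signedFilter_zsupp {K : Set (P → ℤ)} (hK : IsEChain K) {f : P → ℤ}
    (hf : f ∈ K) : signedFilter (esgn K) (zsupp f) = f := by
  ext v
  by_cases hm : Minimal (· ∈ zsupp f) v
  · rw [signedFilter_of_minimal hm, hK.esgn_eq hf hm]
  · by_cases hv : v ∈ zsupp f
    · rw [signedFilter_of_mem hm hv, (hK.1 f hf).2.2 v hv hm]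
    · rw [signedFilter_of_notMem hv, not_not.mp hv]

theorem IsEChain.image_signedFilter {K : Set (P → ℤ)} (hK : IsEChain K) :
    signedFilter (esgn K) '' (zsupp '' K) = K := by
  rw [Set.image_image]
  exact (Set.image_congr fun f hf => hK.signedFilter_zsupp hf).trans (Set.image_id' K)

theorem zsupp_esgn (K : Set (P → ℤ)) : zsupp (esgn K) = ⋃ F ∈ zsupp '' K, minSet F := by
  ext v
  rw [Set.biUnion_image, Set.mem_iUnion₂]
  constructor
  · intro hv
    by_contra h
    exact hv (esgn_eq_zero fun ⟨f, hf, hm⟩ => h ⟨f, hf, hm⟩)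
  · rintro ⟨f, hf, hm⟩
    obtain ⟨g, -, hgv, h⟩ := exists_esgn_eq ⟨f, hf, hm⟩
    exact fun h0 => hgv.prop (h ▸ h0)

theorem IsEChain.esgn_cases {K : Set (P → ℤ)} (hK : IsEChain K) (v : P) :
    esgn K v = 1 ∨ esgn K v = 0 ∨ esgn K v = -1 := by
  by_cases h : ∃ f ∈ K, Minimal (· ∈ zsupp f) v
  · obtain ⟨f, hf, -, h⟩ := exists_esgn_eq h
    rw [h]
    exact (hK.1 f hf).1 v
  · exact .inr (.inl (esgn_eq_zero h))

theorem ege.zsupp_subset {f g : P → ℤ} (h : ege f g) : zsupp g ⊆ zsupp f := by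
  rcases h with rfl | h
  exacts [subset_rfl, h.1.subset]

theorem IsEChain.isChain_zsupp {K : Set (P → ℤ)} (hK : IsEChain K) :
    IsChain (· ⊆ ·) (zsupp '' K) := by
  rintro _ ⟨f, hf, rfl⟩ _ ⟨g, hg, rfl⟩ hne
  exact (hK.2 hf hg fun h => hne (congrArg zsupp h)).symm.imp
    ege.zsupp_subset ege.zsupp_subset

theorem isEChain_image_signedFilter {C : Set (Set P)} {φ : P → ℤ}
    (hC : ∀ F ∈ C, IsOrderFilter F) (hchain : IsChain (· ⊆ ·) C)
    (hφ : ∀ v, φ v = 1 ∨ φ v = 0 ∨ φ v = -1) (hmin : ∀ F ∈ C, minSet F ⊆ zsupp φ) :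
    IsEChain (signedFilter φ '' C) := by
  constructor
  · rintro _ ⟨F, hF, rfl⟩
    exact isEF_signedFilter (hmin F hF) hφ (hC F hF)
  · rintro _ ⟨F, hF, rfl⟩ _ ⟨G, hG, rfl⟩ hne
    have hFG : F ≠ G := fun h => hne (congrArg _ h)
    rcases hchain hF hG hFG with h | h
    · exact .inr (.inr (egt_signedFilter (hmin G hG) (hmin F hF) hφ (h.ssubset_of_ne hFG)))
    · exact .inl (.inr (egt_signedFilter (hmin F hF) (hmin G hG) hφ (h.ssubset_of_ne hFG.symm)))

theorem zsupp_image_signedFilter {C : Set (Set P)} {φ : P → ℤ}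
    (hmin : ∀ F ∈ C, minSet F ⊆ zsupp φ) : zsupp '' (signedFilter φ '' C) = C := by
  rw [Set.image_image]
  exact (Set.image_congr fun F hF => zsupp_signedFilter (hmin F hF)).trans (Set.image_id' C)

theorem esgn_image_signedFilter {C : Set (Set P)} {φ : P → ℤ}
    (hφ : zsupp φ = ⋃ F ∈ C, minSet F) : esgn (signedFilter φ '' C) = φ := by
  have hmin : ∀ F ∈ C, minSet F ⊆ zsupp φ := fun F hF => hφ ▸ Set.subset_biUnion_of_mem hF
  ext v
  by_cases h : ∃ f ∈ signedFilter φ '' C, Minimal (· ∈ zsupp f) v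
  · obtain ⟨_, ⟨F, hF, rfl⟩, hm, h⟩ := exists_esgn_eq h
    rw [zsupp_signedFilter (hmin F hF)] at hm
    rw [h, signedFilter_of_minimal hm]
  · rw [esgn_eq_zero h]
    by_contra hv
    obtain ⟨F, hF, hm⟩ := Set.mem_iUnion₂.mp (hφ ▸ Ne.symm hv : v ∈ ⋃ F ∈ C, minSet F)
    refine h ⟨_, ⟨F, hF, rfl⟩, ?_⟩
    rwa [zsupp_signedFilter (hmin F hF)]

end SignedFilter

theorem stmt8 {P : Type*} [Fintype P] [PartialOrder P] :
    Set.BijOn (fun K : Set (P → ℤ) => (zsupp '' K, esgn K))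
      {K : Set (P → ℤ) | IsEChain K}
      {p : Set (Set P) × (P → ℤ) |
        (∀ F ∈ p.1, IsOrderFilter F) ∧ IsChain (· ⊆ ·) p.1 ∧
        (∀ v, p.2 v = 1 ∨ p.2 v = 0 ∨ p.2 v = -1) ∧
        zsupp p.2 = ⋃ F ∈ p.1, minSet F} := by
  refine ⟨fun K hK => ?_, fun K hK L hL h => ?_, ?_⟩
  · refine ⟨?_, IsEChain.isChain_zsupp hK, IsEChain.esgn_cases hK, zsupp_esgn K⟩
    rintro _ ⟨f, hf, rfl⟩
    exact (hK.1 f hf).2.1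
  · obtain ⟨hsupp, hsgn⟩ := Prod.mk.inj h
    rw [← IsEChain.image_signedFilter hK, hsupp, hsgn, IsEChain.image_signedFilter hL]
  · rintro ⟨C, φ⟩ ⟨hC, hchain, hφ, hsupp⟩
    have hmin : ∀ F ∈ C, minSet F ⊆ zsupp φ := fun F hF =>
      (Set.subset_biUnion_of_mem (u := minSet) hF).trans hsupp.superset
    exact ⟨signedFilter φ '' C, isEChain_image_signedFilter hC hchain hφ hmin,
      Prod.ext (zsupp_image_signedFilter hmin) (esgn_image_signedFilter hsupp)⟩
end

section
/- For every ε ∈ {1,-1}^P one has eC_ε(P) = conv(eA_ε(P)) = R_ε(C(P)); that is, the part of the enriched chain polytope lying in the orthant V_ε equals the convex hull of the set of ±1-antichain indicator vectors lying in V_ε, and equals the image of the chain polytope C(P) under the sign-change map R_ε. -/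
open Classical

/-- The indicator vectors of antichains, that is, the generators of the chain polytope. -/
def antichainIndicators (P : Type*) [PartialOrder P] : Set (P → ℝ) :=
  {g : P → ℝ | ∃ A : Set P, IsAntichain (· ≤ ·) A ∧ g = fun v => if v ∈ A then 1 else 0}

theorem chainPolytope_eq (P : Type*) [PartialOrder P] :
    chainPolytope P = convexHull ℝ (antichainIndicators P) := rfl

/-- The sign-change map as a linear map. -/
def RmapLinear {P : Type*} (φ : P → ℤ) : (P → ℝ) →ₗ[ℝ] (P → ℝ) where
  toFun := Rmap φ
  map_add' g h := by
    funext v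
    simp only [Rmap, Pi.add_apply]
    split_ifs <;> ring
  map_smul' c g := by
    funext v
    simp only [Rmap, Pi.smul_apply, smul_eq_mul, RingHom.id_apply]
    split_ifs <;> ring

theorem Rmap_Rmap {P : Type*} (φ : P → ℤ) (g : P → ℝ) : Rmap φ (Rmap φ g) = g := by
  funext v
  simp only [Rmap]
  split_ifs <;> ring

theorem Rmap_eq_abs {P : Type*} {ε : P → ℤ} (hε : ∀ v, ε v = 1 ∨ ε v = -1) {g : P → ℝ}
    (hg : g ∈ Vset ε) : Rmap ε g = |g| := by
  funext v
  obtain ⟨h1, -, h2⟩ := hg v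
  rcases hε v with h | h
  · simp [Rmap, h, abs_of_nonneg (h1 h)]
  · simp [Rmap, h, abs_of_nonpos (h2 h)]

theorem convex_Vset {P : Type*} (φ : P → ℤ) : Convex ℝ (Vset φ) := by
  intro x hx y hy a b ha hb _ v
  obtain ⟨x1, x0, xm⟩ := hx v
  obtain ⟨y1, y0, ym⟩ := hy v
  simp only [Pi.add_apply, Pi.smul_apply, smul_eq_mul]
  refine ⟨fun h => ?_, fun h => ?_, fun h => ?_⟩
  · have := x1 h
    have := y1 h
    positivity
  · simp [x0 h, y0 h]
  · nlinarith [mul_nonneg ha (neg_nonneg.2 (xm h)), mul_nonneg hb (neg_nonneg.2 (ym h))]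

theorem abs_mem_antichainIndicators {P : Type*} [PartialOrder P] {g : P → ℝ} (hg : g ∈ eAset P) :
    |g| ∈ antichainIndicators P := by
  refine ⟨{v | g v ≠ 0}, hg.2, funext fun v => ?_⟩
  rcases hg.1 v with h | h | h <;> simp [h]

theorem Rmap_image_antichainIndicators {P : Type*} [PartialOrder P] {ε : P → ℤ}
    (hε : ∀ v, ε v = 1 ∨ ε v = -1) :
    Rmap ε '' antichainIndicators P = eAset P ∩ Vset ε := by
  ext g
  constructor
  · rintro ⟨_, ⟨A, hA, rfl⟩, rfl⟩
    refine ⟨⟨fun v => ?_, hA.subset fun v hv => ?_⟩, fun v => ?_⟩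
    · by_cases h : v ∈ A <;> rcases hε v with h' | h' <;> simp [Rmap, h, h']
    · by_contra h
      simp [Rmap, h] at hv
    · by_cases h : v ∈ A <;> rcases hε v with h' | h' <;> simp [Rmap, h, h']
  · rintro ⟨hg, hV⟩
    exact ⟨|g|, abs_mem_antichainIndicators hg, by rw [← Rmap_eq_abs hε hV, Rmap_Rmap]⟩

theorem convexHull_eAset_inter_Vset {P : Type*} [PartialOrder P] {ε : P → ℤ}
    (hε : ∀ v, ε v = 1 ∨ ε v = -1) :
    convexHull ℝ (eAset P ∩ Vset ε) = Rmap ε '' chainPolytope P := by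
  rw [← Rmap_image_antichainIndicators hε, chainPolytope_eq]
  exact ((RmapLinear ε).image_convexHull _).symm

/-- The chain polytope is stable under rescaling each coordinate by a factor in `[0, 1]`. -/
theorem mul_mem_chainPolytope {P : Type*} [Finite P] [PartialOrder P] {s z : P → ℝ}
    (hs : ∀ v, s v ∈ Set.Icc (0 : ℝ) 1) (hz : z ∈ chainPolytope P) : s * z ∈ chainPolytope P := by
  have hcube : s ∈ convexHull ℝ (Set.univ.pi fun _ : P => ({0, 1} : Set ℝ)) := by
    rw [convexHull_pi]
    intro v _
    rw [convexHull_pair, segment_eq_Icc zero_le_one]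
    exact hs v
  refine convexHull_min (t := LinearMap.mulRight ℝ z ⁻¹' chainPolytope P) (fun t ht => ?_)
    ((convex_convexHull ℝ _).linear_preimage _) hcube
  refine convexHull_min (t := LinearMap.mulLeft ℝ t ⁻¹' chainPolytope P) ?_
    ((convex_convexHull ℝ _).linear_preimage _) hz
  rintro _ ⟨A, hA, rfl⟩
  refine subset_convexHull ℝ _ ⟨{v ∈ A | t v = 1}, hA.subset (Set.sep_subset _ _), ?_⟩
  funext v
  have htv : t v = 0 ∨ t v = 1 := ht v trivial
  by_cases h : v ∈ A <;> rcases htv with h' | h' <;> simp [h, h']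

theorem mem_chainPolytope_of_le {P : Type*} [Finite P] [PartialOrder P] {y z : P → ℝ}
    (hy : 0 ≤ y) (hyz : y ≤ z) (hz : z ∈ chainPolytope P) : y ∈ chainPolytope P := by
  have h : y = (fun v => y v / z v) * z := by
    funext v
    rcases eq_or_ne (z v) 0 with h | h
    · simpa [h] using le_antisymm ((hyz v).trans_eq h) (hy v)
    · simp [h]
  rw [h]
  exact mul_mem_chainPolytope (fun v => ⟨div_nonneg (hy v) ((hy v).trans (hyz v)),
    div_le_one_of_le₀ (hyz v) ((hy v).trans (hyz v))⟩) hz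

theorem exists_abs_le_of_mem_eChainPolytope {P : Type*} [PartialOrder P] {x : P → ℝ}
    (hx : x ∈ eChainPolytope P) : ∃ z ∈ chainPolytope P, |x| ≤ z := by
  refine convexHull_min (t := {x | ∃ z ∈ chainPolytope P, |x| ≤ z}) (fun g hg => ?_) ?_ hx
  · exact ⟨|g|, subset_convexHull ℝ _ (abs_mem_antichainIndicators hg), le_rfl⟩
  · rintro x ⟨z, hz, hxz⟩ y ⟨w, hw, hyw⟩ a b ha hb hab
    refine ⟨a • z + b • w, convex_convexHull ℝ _ hz hw ha hb hab, fun v => ?_⟩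
    calc |a * x v + b * y v| ≤ |a * x v| + |b * y v| := abs_add_le _ _
      _ = a * |x v| + b * |y v| := by rw [abs_mul, abs_mul, abs_of_nonneg ha, abs_of_nonneg hb]
      _ ≤ a * z v + b * w v := by
        gcongr
        · exact hxz v
        · exact hyw v

theorem eChainPolytope_inter_Vset {P : Type*} [Finite P] [PartialOrder P] {ε : P → ℤ}
    (hε : ∀ v, ε v = 1 ∨ ε v = -1) :
    eChainPolytope P ∩ Vset ε = Rmap ε '' chainPolytope P := by
  apply Set.Subset.antisymm
  · rintro x ⟨hx, hV⟩
    obtain ⟨z, hz, hxz⟩ := exists_abs_le_of_mem_eChainPolytope hx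
    exact ⟨|x|, mem_chainPolytope_of_le (abs_nonneg x) hxz hz,
      by rw [← Rmap_eq_abs hε hV, Rmap_Rmap]⟩
  · rw [← convexHull_eAset_inter_Vset hε]
    exact Set.subset_inter (convexHull_mono Set.inter_subset_left)
      (convexHull_min Set.inter_subset_right (convex_Vset ε))

theorem stmt11 {P : Type*} [Fintype P] [PartialOrder P] (ε : P → ℤ)
    (hε : ∀ v, ε v = 1 ∨ ε v = -1) :
    eChainPolytope P ∩ Vset ε = convexHull ℝ (eAset P ∩ Vset ε) ∧
    eChainPolytope P ∩ Vset ε = Rmap ε '' chainPolytope P := by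
  have h := eChainPolytope_inter_Vset (P := P) hε
  exact ⟨h.trans (convexHull_eAset_inter_Vset hε).symm, h⟩
end

section
/- Let f_1, f_2 ∈ E(P) and φ ∈ {1,0,-1}^P, and let f'_1, f'_2 ∈ E(P) be the unique elements satisfying R_φ(Φᵉ(f_1)) = Φᵉ(f'_1) and R_φ(Φᵉ(f_2)) = Φᵉ(f'_2). Then f_1 > f_2 implies f'_1 > f'_2. -/
open Classical

theorem ePhi_ne_zero_iff {P : Type*} [PartialOrder P] {f : P → ℤ} {v : P} :
    ePhi f v ≠ 0 ↔ Minimal (· ∈ zsupp f) v := by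
  unfold ePhi
  split_ifs with h
  · exact iff_of_true (Int.cast_ne_zero.2 h.1) h
  · exact iff_of_false (fun h0 => h0 rfl) h

theorem Rmap_ne_zero_iff {P : Type*} {φ : P → ℤ} {g : P → ℝ} {v : P} :
    Rmap φ g v ≠ 0 ↔ g v ≠ 0 := by
  unfold Rmap
  split_ifs <;> simp

theorem minimal_zsupp_iff_of_Rmap {P : Type*} [PartialOrder P] {f f' : P → ℤ} {φ : P → ℤ}
    (h : Rmap φ (ePhi f) = ePhi f') (v : P) :
    Minimal (· ∈ zsupp f) v ↔ Minimal (· ∈ zsupp f') v := by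
  rw [← ePhi_ne_zero_iff, ← ePhi_ne_zero_iff, ← h, Rmap_ne_zero_iff]

/-- An order filter of a finite poset is contained in any order filter that contains its
minimal elements. -/
theorem IsOrderFilter.subset_of_minimal {P : Type*} [Finite P] [PartialOrder P] {F G : Set P}
    (hG : IsOrderFilter G) (h : ∀ v, Minimal (· ∈ F) v → v ∈ G) : F ⊆ G := by
  intro v hv
  obtain ⟨u, huv, hu⟩ := (Set.toFinite F).exists_le_minimal hv
  exact hG (h u hu) huv

theorem zsupp_eq_of_Rmap {P : Type*} [Finite P] [PartialOrder P] {f f' : P → ℤ} {φ : P → ℤ}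
    (hf : IsEF f) (hf' : IsEF f') (h : Rmap φ (ePhi f) = ePhi f') : zsupp f = zsupp f' :=
  Set.Subset.antisymm
    (hf'.2.1.subset_of_minimal fun v hv => ((minimal_zsupp_iff_of_Rmap h v).1 hv).1)
    (hf.2.1.subset_of_minimal fun v hv => ((minimal_zsupp_iff_of_Rmap h v).2 hv).1)

theorem apply_eq_of_Rmap {P : Type*} [PartialOrder P] {f f' : P → ℤ} {φ : P → ℤ}
    (h : Rmap φ (ePhi f) = ePhi f') {v : P} (hv : Minimal (· ∈ zsupp f) v) :
    f' v = if φ v = -1 then -f v else f v := by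
  have hv' := (minimal_zsupp_iff_of_Rmap h v).1 hv
  have key := congrFun h v
  simp only [Rmap, ePhi, if_pos hv, if_pos hv'] at key
  split_ifs at key ⊢ <;> exact_mod_cast key.symm

theorem stmt17 {P : Type*} [Fintype P] [PartialOrder P]
    {f₁ f₂ f₁' f₂' : P → ℤ} (hf₁ : IsEF f₁) (hf₂ : IsEF f₂)
    (hf₁' : IsEF f₁') (hf₂' : IsEF f₂')
    (φ : P → ℤ) (hφ : ∀ v, φ v = 1 ∨ φ v = 0 ∨ φ v = -1)
    (h1 : Rmap φ (ePhi f₁) = ePhi f₁') (h2 : Rmap φ (ePhi f₂) = ePhi f₂')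
    (hgt : egt f₁ f₂) : egt f₁' f₂' := by
  have e₁ := zsupp_eq_of_Rmap hf₁ hf₁' h1
  have e₂ := zsupp_eq_of_Rmap hf₂ hf₂' h2
  obtain ⟨hss, -, heq⟩ := hgt
  have agree : ∀ v ∈ zsupp f₂, Minimal (· ∈ zsupp f₁) v → f₁' v = f₂' v := by
    intro v hv hm
    have hm₂ : Minimal (· ∈ zsupp f₂) v := ⟨hv, fun u hu => hm.2 (hss.1 hu)⟩
    rw [apply_eq_of_Rmap h1 hm, apply_eq_of_Rmap h2 hm₂, heq v hv hm]
  unfold egt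
  rw [← e₁, ← e₂]
  refine ⟨hss, fun v hv => ?_, agree⟩
  by_cases hm : Minimal (· ∈ zsupp f₁) v
  · exact (agree v hv hm).ge
  · rw [hf₁'.2.2 v (e₁ ▸ hss.1 hv) (e₁ ▸ hm)]
    rcases hf₂'.1 v with h | h | h <;> omega
end

section
/- The enriched chain polytope eC(P) is the union, over all chains K in the poset E(P), of the simplices T^e_K; in particular T^e_K ⊆ eC(P) for every chain K in E(P). -/
open Classical

open MeasureTheory

section ChainWeight

variable {P : Type*} [Fintype P] [PartialOrder P]

/-- The maximal total weight `∑ |x v|` of a chain contained in `S`. -/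
noncomputable def chainWeight (x : P → ℝ) (S : Set P) : ℝ :=
  (Finset.univ.filter fun C : Finset P => IsChain (· ≤ ·) (C : Set P) ∧ (C : Set P) ⊆ S).sup'
    ⟨∅, by simp⟩ fun C => ∑ v ∈ C, |x v|

theorem sum_le_chainWeight (x : P → ℝ) {S : Set P} {C : Finset P}
    (hC : IsChain (· ≤ ·) (C : Set P)) (hS : (C : Set P) ⊆ S) :
    ∑ v ∈ C, |x v| ≤ chainWeight x S :=
  Finset.le_sup' (fun C : Finset P => ∑ v ∈ C, |x v|) (by simp [hC, hS])

theorem exists_chainWeight_eq (x : P → ℝ) (S : Set P) :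
    ∃ C : Finset P, IsChain (· ≤ ·) (C : Set P) ∧ (C : Set P) ⊆ S ∧
      chainWeight x S = ∑ v ∈ C, |x v| := by
  obtain ⟨C, hC, h⟩ := Finset.exists_mem_eq_sup'
    (s := Finset.univ.filter fun C : Finset P =>
      IsChain (· ≤ ·) (C : Set P) ∧ (C : Set P) ⊆ S)
    ⟨∅, by simp⟩ fun C => ∑ v ∈ C, |x v|
  rw [Finset.mem_filter] at hC
  exact ⟨C, hC.2.1, hC.2.2, h⟩

theorem chainWeight_mono (x : P → ℝ) {S T : Set P} (h : S ⊆ T) :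
    chainWeight x S ≤ chainWeight x T := by
  obtain ⟨C, hC, hS, e⟩ := exists_chainWeight_eq x S
  exact e ▸ sum_le_chainWeight x hC (hS.trans h)

theorem chainWeight_nonneg (x : P → ℝ) (S : Set P) : 0 ≤ chainWeight x S := by
  obtain ⟨C, -, -, e⟩ := exists_chainWeight_eq x S
  exact e ▸ Finset.sum_nonneg fun _ _ => abs_nonneg _

theorem chainWeight_Iic (x : P → ℝ) (v : P) :
    chainWeight x (Set.Iic v) = |x v| + chainWeight x (Set.Iio v) := by
  apply le_antisymm
  · obtain ⟨C, hC, hS, e⟩ := exists_chainWeight_eq x (Set.Iic v)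
    have hsub : ((C.erase v : Finset P) : Set P) ⊆ Set.Iio v := fun u hu => by
      simp only [Finset.coe_erase, Set.mem_sdiff, Set.mem_singleton_iff] at hu
      exact lt_of_le_of_ne (hS hu.1) hu.2
    have h := sum_le_chainWeight x (hC.mono (by simp)) hsub
    rw [e]
    by_cases hv : v ∈ C
    · rw [← Finset.add_sum_erase C _ hv]
      gcongr
    · rw [Finset.erase_eq_of_notMem hv] at h
      linarith [abs_nonneg (x v)]
  · obtain ⟨C, hC, hS, e⟩ := exists_chainWeight_eq x (Set.Iio v)
    have hv : v ∉ C := fun h => lt_irrefl v (hS h)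
    rw [e, ← Finset.sum_insert (f := fun u => |x u|) hv]
    apply sum_le_chainWeight
    · rw [Finset.coe_insert]
      exact hC.insert fun b hb _ => Or.inr (hS hb).le
    · intro u hu
      rcases Finset.mem_insert.1 (Finset.mem_coe.1 hu) with rfl | hu
      · exact le_rfl
      · exact (hS hu).le

theorem chainWeight_Iio_lt_iff (x : P → ℝ) (v : P) {t : ℝ} (ht : 0 < t) :
    chainWeight x (Set.Iio v) < t ↔ ∀ u < v, chainWeight x (Set.Iic u) < t := by
  constructor
  · intro h u hu
    exact (chainWeight_mono x fun w hw => lt_of_le_of_lt hw hu).trans_lt h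
  · intro h
    obtain ⟨C, hC, hS, e⟩ := exists_chainWeight_eq x (Set.Iio v)
    rcases C.eq_empty_or_nonempty with rfl | hne
    · simpa [e] using ht
    · obtain ⟨u, hu⟩ := C.exists_maximal hne
      rw [e]
      refine (sum_le_chainWeight x hC fun w hw => ?_).trans_lt (h u (hS hu.1))
      rcases hC.total hw hu.1 with h' | h'
      · exact h'
      · exact hu.2 hw h'

theorem minimal_chainWeight_iff (x : P → ℝ) (v : P) {t : ℝ} (ht : 0 < t) :
    Minimal (fun u => t ≤ chainWeight x (Set.Iic u)) v ↔
      t ∈ Set.Ioc (chainWeight x (Set.Iio v)) (chainWeight x (Set.Iic v)) := by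
  rw [Set.mem_Ioc, chainWeight_Iio_lt_iff x v ht, minimal_iff_forall_lt, and_comm]
  simp only [not_le]

/-- The element of `E(P)` supported on the level filter of `chainWeight` at height `t`, with the
signs of `x` on the minimal elements of that filter. -/
noncomputable def levelMap (x : P → ℝ) (t : ℝ) (v : P) : ℤ :=
  if t ≤ chainWeight x (Set.Iic v) then
    if Minimal (fun u => t ≤ chainWeight x (Set.Iic u)) v ∧ x v < 0 then -1 else 1
  else 0

theorem mem_zsupp_levelMap (x : P → ℝ) (t : ℝ) (v : P) :
    v ∈ zsupp (levelMap x t) ↔ t ≤ chainWeight x (Set.Iic v) := by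
  simp only [zsupp, levelMap, Set.mem_ofPred_eq]
  split_ifs <;> simp_all

theorem isEF_levelMap (x : P → ℝ) (t : ℝ) : IsEF (levelMap x t) := by
  refine ⟨fun v => ?_, fun u v hu huv => ?_, fun v hv hm => ?_⟩
  · unfold levelMap
    split_ifs <;> simp
  · rw [mem_zsupp_levelMap] at hu ⊢
    exact hu.trans (chainWeight_mono x (Set.Iic_subset_Iic.2 huv))
  · simp only [mem_zsupp_levelMap] at hv hm
    simp [levelMap, hv, hm]

theorem ege_levelMap (x : P → ℝ) {s t : ℝ} (h : s ≤ t) :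
    ege (levelMap x s) (levelMap x t) := by
  have hsub : zsupp (levelMap x t) ⊆ zsupp (levelMap x s) := fun v hv => by
    rw [mem_zsupp_levelMap] at hv ⊢
    exact h.trans hv
  have hmin : ∀ v ∈ zsupp (levelMap x t), Minimal (· ∈ zsupp (levelMap x s)) v →
      levelMap x s v = levelMap x t v := fun v hv hm => by
    have hm' : Minimal (· ∈ zsupp (levelMap x t)) v := ⟨hv, fun u hu => hm.2 (hsub hu)⟩
    have hv' := hsub hv
    simp only [mem_zsupp_levelMap] at hv hv' hm hm'
    simp [levelMap, hv, hv', hm, hm']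
  by_cases he : zsupp (levelMap x s) = zsupp (levelMap x t)
  · left
    funext v
    by_cases hv : v ∈ zsupp (levelMap x t)
    · by_cases hm : Minimal (· ∈ zsupp (levelMap x s)) v
      · exact hmin v hv hm
      · rw [(isEF_levelMap x s).2.2 v (hsub hv) hm, (isEF_levelMap x t).2.2 v hv (he ▸ hm)]
    · have hv' := he ▸ hv
      simp only [zsupp, Set.mem_ofPred_eq, not_not] at hv hv'
      rw [hv, hv']
  · refine Or.inr ⟨hsub.ssubset_of_ne (Ne.symm he), fun v hv => ?_, hmin⟩
    by_cases hm : Minimal (· ∈ zsupp (levelMap x s)) v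
    · exact (hmin v hv hm).ge
    · rw [(isEF_levelMap x s).2.2 v (hsub hv) hm]
      rcases (isEF_levelMap x t).1 v with h | h | h <;> omega

theorem isEChain_range_levelMap (x : P → ℝ) : IsEChain (Set.range (levelMap x)) := by
  constructor
  · rintro _ ⟨t, rfl⟩
    exact isEF_levelMap x t
  · rintro _ ⟨s, rfl⟩ _ ⟨t, rfl⟩ -
    exact (le_total s t).imp (ege_levelMap x) (ege_levelMap x)

theorem ePhi_levelMap (x : P → ℝ) {t : ℝ} (ht : 0 < t) (v : P) :
    ePhi (levelMap x t) v =
      (Set.Ioc (chainWeight x (Set.Iio v)) (chainWeight x (Set.Iic v))).indicator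
        (fun _ => if x v < 0 then (-1 : ℝ) else 1) t := by
  simp only [ePhi, mem_zsupp_levelMap, levelMap, Set.indicator_apply,
    ← minimal_chainWeight_iff x v ht]
  by_cases hm : Minimal (fun u => t ≤ chainWeight x (Set.Iic u)) v
  · have := hm.1
    split_ifs <;> simp_all
  · simp [hm]

theorem mem_Tsimp_range_levelMap (x : P → ℝ)
    (hx : ∀ v, chainWeight x (Set.Iic v) ≤ 1) : x ∈ Tsimp (Set.range (levelMap x)) := by
  let μ : Measure ℝ := volume.restrict (Set.Ioc 0 1)
  have : IsProbabilityMeasure μ := ⟨by simp [μ]⟩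
  have hae (v : P) : (fun t => ePhi (levelMap x t) v) =ᵐ[μ]
      (Set.Ioc (chainWeight x (Set.Iio v)) (chainWeight x (Set.Iic v))).indicator
        (fun _ => if x v < 0 then (-1 : ℝ) else 1) :=
    (ae_restrict_mem measurableSet_Ioc).mono fun t ht => ePhi_levelMap x ht.1 v
  have hint : Integrable (fun t => ePhi (levelMap x t)) μ := Integrable.of_eval fun v =>
    (((integrable_const _).indicator measurableSet_Ioc).congr (hae v).symm)
  have hfin : (ePhi '' Set.range (levelMap x)).Finite := by
    apply Set.Finite.image
    apply (Set.Finite.pi' fun _ : P => (Set.toFinite ({1, 0, -1} : Set ℤ))).subset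
    rintro _ ⟨t, rfl⟩ v
    simpa using (isEF_levelMap x t).1 v
  have hmem := (convex_convexHull ℝ (ePhi '' Set.range (levelMap x))).integral_mem
    (hfin.isClosed_convexHull ℝ)
    (Filter.Eventually.of_forall fun t => subset_convexHull ℝ _ ⟨_, ⟨t, rfl⟩, rfl⟩) hint
  have heq : ∫ t, ePhi (levelMap x t) ∂μ = x := by
    funext v
    have hsub : Set.Ioc (chainWeight x (Set.Iio v)) (chainWeight x (Set.Iic v)) ⊆ Set.Ioc 0 1 :=
      Set.Ioc_subset_Ioc (chainWeight_nonneg x _) (hx v)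
    rw [eval_integral fun v => hint.eval v, integral_congr_ae (hae v),
      integral_indicator measurableSet_Ioc, setIntegral_const,
      measureReal_restrict_apply measurableSet_Ioc, Set.inter_eq_left.2 hsub,
      Real.volume_real_Ioc, chainWeight_Iic, add_sub_cancel_right, max_eq_left (abs_nonneg _),
      smul_eq_mul]
    split_ifs with h
    · rw [abs_of_neg h]; ring
    · rw [abs_of_nonneg (not_lt.1 h), mul_one]
  rwa [heq] at hmem

end ChainWeight

theorem sum_abs_le_one_of_mem_eChainPolytope {P : Type*} [PartialOrder P] {x : P → ℝ}
    (hx : x ∈ eChainPolytope P) {C : Finset P} (hC : IsChain (· ≤ ·) (C : Set P)) : ∑ v ∈ C, |x v| ≤ 1 := by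
  have hconv : Convex ℝ {y : P → ℝ | ∑ v ∈ C, |y v| ≤ 1} := by
    intro p hp q hq a b ha hb hab
    calc ∑ v ∈ C, |(a • p + b • q) v| ≤ ∑ v ∈ C, (a * |p v| + b * |q v|) := by
          refine Finset.sum_le_sum fun v _ => (abs_add_le _ _).trans_eq ?_
          simp [abs_mul, abs_of_nonneg ha, abs_of_nonneg hb]
      _ = a * ∑ v ∈ C, |p v| + b * ∑ v ∈ C, |q v| := by
          rw [Finset.sum_add_distrib, Finset.mul_sum, Finset.mul_sum]
      _ ≤ a * 1 + b * 1 := by gcongr <;> assumption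
      _ = 1 := by rw [← add_mul, hab, one_mul]
  refine convexHull_min ?_ hconv hx
  rintro g ⟨hg, hanti⟩
  by_cases h : ∃ v ∈ C, g v ≠ 0
  · obtain ⟨v, hv, hgv⟩ := h
    have hz : ∀ u ∈ C, u ≠ v → |g u| = 0 := fun u hu huv => by
      by_contra hgu
      rw [abs_eq_zero] at hgu
      rcases hC.total hu hv with h | h
      · exact hanti hgu hgv huv h
      · exact hanti hgv hgu huv.symm h
    rw [Set.mem_ofPred_eq, Finset.sum_eq_single_of_mem v hv hz]
    rcases hg v with h | h | h <;> simp [h]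
  · push Not at h
    rw [Set.mem_ofPred_eq, Finset.sum_eq_zero fun v hv => by rw [h v hv, abs_zero]]
    exact zero_le_one

theorem ePhi_mem_eAset {P : Type*} [PartialOrder P] {f : P → ℤ} (hf : IsEF f) :
    ePhi f ∈ eAset P := by
  constructor
  · intro v
    unfold ePhi
    split_ifs
    · exact_mod_cast hf.1 v
    · simp
  · refine (setOfPred_minimal_antichain (· ∈ zsupp f)).subset fun v hv => ?_
    by_contra h
    exact hv (if_neg h)

theorem Tsimp_subset_eChainPolytope {P : Type*} [PartialOrder P] {K : Set (P → ℤ)}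
    (hK : IsEChain K) : Tsimp K ⊆ eChainPolytope P :=
  convexHull_mono (Set.image_subset_iff.2 fun f hf => ePhi_mem_eAset (hK.1 f hf))

theorem stmt19 {P : Type*} [Fintype P] [PartialOrder P] :
    (eChainPolytope P = ⋃ K ∈ {K : Set (P → ℤ) | IsEChain K}, Tsimp K) ∧
    ∀ K : Set (P → ℤ), IsEChain K → Tsimp K ⊆ eChainPolytope P := by
  refine ⟨Set.Subset.antisymm (fun x hx => ?_)
    (Set.iUnion₂_subset fun K hK => Tsimp_subset_eChainPolytope hK),
    fun K hK => Tsimp_subset_eChainPolytope hK⟩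
  refine Set.mem_biUnion (isEChain_range_levelMap x) (mem_Tsimp_range_levelMap x fun v => ?_)
  obtain ⟨C, hC, -, e⟩ := exists_chainWeight_eq x (Set.Iic v)
  exact e ▸ sum_abs_le_one_of_mem_eChainPolytope hx hC
end
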